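/- arXiv:math/0601007 — 3 statements merged into one kernel-verified Lean document; each statement's English description precedes it below -/
import Mathlib

section
/- Let F be the centered Gaussian process with covariance E[F(s)F(t)] = (2π)^{-1/2}(√(t+s) − √|t−s|). Fix Δt > 0, set t_j = jΔt and ΔF_j = F(t_j) − F(t_{j−1}). Then for all integers 1 ≤ i < j, E[ΔF_i ΔF_j] = −√(Δt/(2π)) ( γ_{j+i−1} + γ_{j−i} ), where γ_k = 2√k − √(k−1) − √(k+1); in particular E[ΔF_i ΔF_j] < 0, i.e., distinct increments of F over a uniform grid are negatively correlated. -/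
open MeasureTheory ProbabilityTheory Filter

/-- The covariance function `K(s,t) = (2π)^{-1/2}(√(t+s) − √|t−s|)`. -/
noncomputable def covK (s t : ℝ) : ℝ :=
  (Real.sqrt (2 * Real.pi))⁻¹ * (Real.sqrt (t + s) - Real.sqrt |t - s|)

/-- `F` is the centered Gaussian process with covariance `covK`, on a probability
space `(Ω, P)`: every finite linear combination of values of `F` at nonnegative
times is centered Gaussian with the prescribed variance. -/
def IsHeatGaussian {Ω : Type*} [MeasurableSpace Ω] (P : Measure Ω)
    (F : ℝ → Ω → ℝ) : Prop :=
  IsProbabilityMeasure P ∧ (∀ t : ℝ, Measurable (F t)) ∧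
  ∀ (m : ℕ) (ts : Fin m → ℝ) (c : Fin m → ℝ), (∀ i, 0 ≤ ts i) →
    Measure.map (fun ω => ∑ i, c i * F (ts i) ω) P =
      gaussianReal 0 (Real.toNNReal (∑ i, ∑ j, c i * c j * covK (ts i) (ts j)))

/-- `γ_k = 2√k − √(k−1) − √(k+1)`. -/
noncomputable def gam (k : ℕ) : ℝ :=
  2 * Real.sqrt k - Real.sqrt ((k : ℝ) - 1) - Real.sqrt ((k : ℝ) + 1)

lemma covK_comm (s t : ℝ) : covK s t = covK t s := by
  rw [covK, covK, add_comm, abs_sub_comm]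

lemma covK_nonneg {s t : ℝ} (hs : 0 ≤ s) (ht : 0 ≤ t) : 0 ≤ covK s t := by
  refine mul_nonneg (by positivity) (sub_nonneg.2 (Real.sqrt_le_sqrt ?_))
  rw [abs_le]
  constructor <;> linarith

/-- The covariance of the grid values `F (a Δt)` and `F (b Δt)` for `a ≤ b`. -/
lemma covK_mul_mul {a b d : ℝ} (hd : 0 ≤ d) (ha : 0 ≤ a) (hab : a ≤ b) :
    covK (a * d) (b * d) =
      Real.sqrt (d / (2 * Real.pi)) * (Real.sqrt (a + b) - Real.sqrt (b - a)) := by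
  have habs : |b * d - a * d| = (b - a) * d := by
    rw [← sub_mul, abs_of_nonneg (mul_nonneg (sub_nonneg.2 hab) hd)]
  rw [covK, habs, ← add_mul, Real.sqrt_mul (show 0 ≤ b + a by linarith),
    Real.sqrt_mul (sub_nonneg.2 hab),
    Real.sqrt_div hd, add_comm b a]
  ring

lemma gam_pos {k : ℕ} (hk : 1 ≤ k) : 0 < gam k := by
  have hk' : (1 : ℝ) ≤ k := by exact_mod_cast hk
  have h := And.right Real.strictConcaveOn_sqrt
    (show (k : ℝ) - 1 ∈ Set.Ici 0 from Set.mem_Ici.2 (by linarith))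
    (show (k : ℝ) + 1 ∈ Set.Ici 0 from Set.mem_Ici.2 (by linarith)) (by linarith)
    (show (0 : ℝ) < 1 / 2 by norm_num) (show (0 : ℝ) < 1 / 2 by norm_num) (by norm_num)
  have hmid : (1 / 2 : ℝ) • ((k : ℝ) - 1) + (1 / 2 : ℝ) • ((k : ℝ) + 1) = k := by
    simp only [smul_eq_mul]; ring
  rw [hmid] at h
  simp only [smul_eq_mul] at h
  rw [gam]
  linarith

section CenteredGaussian

variable {Ω : Type*} [MeasurableSpace Ω] {P : Measure Ω}

lemma memLp_two_of_map_eq_gaussianReal {X : Ω → ℝ} {μ : ℝ} {v : NNReal}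
    (hX : Measurable X) (h : P.map X = gaussianReal μ v) : MemLp X 2 P := by
  have hid : MemLp id 2 (P.map X) := h ▸ memLp_id_gaussianReal 2
  exact (memLp_map_measure_iff aestronglyMeasurable_id hX.aemeasurable).1 hid

lemma integral_sq_of_map_eq_gaussianReal {X : Ω → ℝ} {v : NNReal}
    (hX : Measurable X) (h : P.map X = gaussianReal 0 v) : ∫ ω, X ω ^ 2 ∂P = v := by
  have hvar := variance_fun_id_gaussianReal (μ := 0) (v := v)
  rw [variance_of_integral_eq_zero (by fun_prop) integral_id_gaussianReal, ← h,
    integral_map hX.aemeasurable (by fun_prop)] at hvar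
  exact hvar

namespace IsHeatGaussian

variable {F : ℝ → Ω → ℝ} {s t : ℝ}

lemma map_eq (hF : IsHeatGaussian P F) (ht : 0 ≤ t) :
    P.map (F t) = gaussianReal 0 (covK t t).toNNReal := by
  simpa using hF.2.2 1 ![t] ![1] (by simpa using ht)

lemma map_add_eq (hF : IsHeatGaussian P F) (hs : 0 ≤ s) (ht : 0 ≤ t) :
    P.map (fun ω => F s ω + F t ω) =
    gaussianReal 0 (covK s s + 2 * covK s t + covK t t).toNNReal := by
  have h := hF.2.2 2 ![s, t] ![1, 1] (by simp [Fin.forall_fin_two, hs, ht])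
  simp only [Fin.sum_univ_two, Matrix.cons_val_zero, Matrix.cons_val_one, one_mul,
    covK_comm t s] at h
  rw [h]
  congr 2
  ring

lemma memLp_two (hF : IsHeatGaussian P F) (ht : 0 ≤ t) : MemLp (F t) 2 P :=
  memLp_two_of_map_eq_gaussianReal (hF.2.1 t) (hF.map_eq ht)

lemma integrable_mul (hF : IsHeatGaussian P F) (hs : 0 ≤ s) (ht : 0 ≤ t) :
    Integrable (fun ω => F s ω * F t ω) P :=
  (hF.memLp_two hs).integrable_mul (hF.memLp_two ht)

lemma integral_mul (hF : IsHeatGaussian P F) (hs : 0 ≤ s) (ht : 0 ≤ t) :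
    ∫ ω, F s ω * F t ω ∂P = covK s t := by
  have hss := covK_nonneg hs hs
  have htt := covK_nonneg ht ht
  have hst := covK_nonneg hs ht
  have es := integral_sq_of_map_eq_gaussianReal (hF.2.1 s) (hF.map_eq hs)
  have et := integral_sq_of_map_eq_gaussianReal (hF.2.1 t) (hF.map_eq ht)
  have est := integral_sq_of_map_eq_gaussianReal ((hF.2.1 s).add (hF.2.1 t))
    (hF.map_add_eq hs ht)
  rw [Real.coe_toNNReal _ (by positivity)] at es et est
  have hexp : ∫ ω, (F s ω + F t ω) ^ 2 ∂P =
      ∫ ω, F s ω ^ 2 ∂P + 2 * ∫ ω, F s ω * F t ω ∂P + ∫ ω, F t ω ^ 2 ∂P := by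
    rw [← integral_const_mul, ← integral_add (hF.memLp_two hs).integrable_sq
      ((hF.integrable_mul hs ht).const_mul 2), ← integral_add
      ((hF.memLp_two hs).integrable_sq.fun_add ((hF.integrable_mul hs ht).const_mul 2))
      (hF.memLp_two ht).integrable_sq]
    congr 1 with ω
    ring
  have est' : ∫ ω, (F s ω + F t ω) ^ 2 ∂P = covK s s + 2 * covK s t + covK t t := est
  linarith

lemma integral_sub_mul_sub (hF : IsHeatGaussian P F) {a b c d : ℝ}
    (ha : 0 ≤ a) (hb : 0 ≤ b) (hc : 0 ≤ c) (hd : 0 ≤ d) :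
    ∫ ω, (F b ω - F a ω) * (F d ω - F c ω) ∂P =
      covK b d - covK b c - (covK a d - covK a c) := by
  rw [← hF.integral_mul hb hd, ← hF.integral_mul hb hc, ← hF.integral_mul ha hd,
    ← hF.integral_mul ha hc, ← integral_sub (hF.integrable_mul hb hd) (hF.integrable_mul hb hc),
    ← integral_sub (hF.integrable_mul ha hd) (hF.integrable_mul ha hc),
    ← integral_sub ((hF.integrable_mul hb hd).sub' (hF.integrable_mul hb hc))
      ((hF.integrable_mul ha hd).sub' (hF.integrable_mul ha hc))]
  congr 1 with ω
  ring

end IsHeatGaussian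

end CenteredGaussian

/-- Equation (2.7): for a uniform grid `t_j = jΔt` and increments
`ΔF_j = F(t_j) − F(t_{j−1})`, for all `1 ≤ i < j`,
`E[ΔF_i ΔF_j] = −√(Δt/(2π))(γ_{j+i−1} + γ_{j−i})`; in particular the
increments are negatively correlated. -/
theorem heat_increment_cov_formula {Ω : Type*} [MeasurableSpace Ω]
    (P : Measure Ω) (F : ℝ → Ω → ℝ) (hF : IsHeatGaussian P F)
    (Δt : ℝ) (hΔt : 0 < Δt) (i j : ℕ) (hi : 1 ≤ i) (hij : i < j) :
    (∫ ω, (F ((i : ℝ) * Δt) ω - F (((i : ℝ) - 1) * Δt) ω) *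
        (F ((j : ℝ) * Δt) ω - F (((j : ℝ) - 1) * Δt) ω) ∂P) =
      -(Real.sqrt (Δt / (2 * Real.pi)) * (gam (j + i - 1) + gam (j - i))) ∧
    (∫ ω, (F ((i : ℝ) * Δt) ω - F (((i : ℝ) - 1) * Δt) ω) *
        (F ((j : ℝ) * Δt) ω - F (((j : ℝ) - 1) * Δt) ω) ∂P) < 0 := by
  have hi' : (1 : ℝ) ≤ i := by exact_mod_cast hi
  have hij' : (i : ℝ) + 1 ≤ j := by exact_mod_cast hij
  have hpos : 0 < Real.sqrt (Δt / (2 * Real.pi)) * (gam (j + i - 1) + gam (j - i)) :=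
    mul_pos (Real.sqrt_pos.2 (by positivity))
      (add_pos (gam_pos (by omega)) (gam_pos (by omega)))
  have key : (∫ ω, (F ((i : ℝ) * Δt) ω - F (((i : ℝ) - 1) * Δt) ω) *
      (F ((j : ℝ) * Δt) ω - F (((j : ℝ) - 1) * Δt) ω) ∂P) =
      -(Real.sqrt (Δt / (2 * Real.pi)) * (gam (j + i - 1) + gam (j - i))) := by
    rw [hF.integral_sub_mul_sub (mul_nonneg (by linarith) hΔt.le)
        (mul_nonneg (by linarith) hΔt.le) (mul_nonneg (by linarith) hΔt.le)
        (mul_nonneg (by linarith) hΔt.le),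
      covK_mul_mul hΔt.le (by linarith) (by linarith),
      covK_mul_mul hΔt.le (by linarith) (by linarith),
      covK_mul_mul hΔt.le (by linarith) (by linarith),
      covK_mul_mul hΔt.le (by linarith) (by linarith),
      gam, gam, Nat.cast_sub hij.le, Nat.cast_sub (by omega : 1 ≤ j + i)]
    push_cast
    rw [show (i : ℝ) + (j - 1) = j + i - 1 by ring, show (i : ℝ) - 1 + j = j + i - 1 by ring,
      show (i : ℝ) - 1 + (j - 1) = j + i - 1 - 1 by ring,
      show (i : ℝ) + j = j + i - 1 + 1 by ring,
      show (j : ℝ) - 1 - i = j - i - 1 by ring, show (j : ℝ) - (i - 1) = j - i + 1 by ring,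
      show (j : ℝ) - 1 - (i - 1) = j - i by ring]
    ring
  exact ⟨key, key ▸ neg_neg_of_pos hpos⟩
end

section
/- The series ∑_{i=1}^∞ K₀(γ_i/2) converges, and 0 < ∑_{i=1}^∞ K₀(γ_i/2) ≤ 4/π + 9√2/112 < 3/2; consequently the constant κ² := 6/π − (4/π) ∑_{i=1}^∞ K₀(γ_i/2) is strictly positive. -/
/-- `K₀(x) = (6/π)x√(1−x²) + (2/π)(1+2x²)arcsin x`. -/
noncomputable def K0 (x : ℝ) : ℝ :=
  6 / Real.pi * x * Real.sqrt (1 - x ^ 2) +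
    2 / Real.pi * (1 + 2 * x ^ 2) * Real.arcsin x

theorem arcsin_le_add_cube {x : ℝ} (h0 : 0 ≤ x) (h1 : x ≤ 3 / 10) :
    Real.arcsin x ≤ x + x ^ 3 / 2 := by
  rcases h0.eq_or_lt with rfl | hpos
  · simp
  have hx2 : x ^ 2 ≤ 9 / 100 := by nlinarith
  have hx3 : x ^ 3 ≤ 9 / 100 * x := by nlinarith
  have ht0 : 0 < x + x ^ 3 / 2 := by positivity
  have hsin := Real.sin_gt_sub_cube ht0
  have hcube : (x + x ^ 3 / 2) ^ 3 ≤ 2 * x ^ 3 := by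
    have hle : x + x ^ 3 / 2 ≤ 21 / 20 * x := by linarith
    calc (x + x ^ 3 / 2) ^ 3 ≤ (21 / 20 * x) ^ 3 := by gcongr
      _ ≤ 2 * x ^ 3 := by nlinarith [pow_pos hpos 3]
  rw [Real.arcsin_le_iff_le_sin' ⟨by linarith [Real.pi_gt_three], by linarith [Real.pi_gt_three]⟩]
  linarith [pow_pos hpos 3]

theorem K0_pos {x : ℝ} (h0 : 0 < x) : 0 < K0 x := by
  have h : 0 < Real.arcsin x := Real.arcsin_pos.mpr h0
  have := Real.pi_pos
  unfold K0
  positivity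

theorem K0_le_linear {x : ℝ} (h0 : 0 ≤ x) (h1 : x ≤ 3 / 10) :
    K0 x ≤ (4 / Real.pi + 1 / 10) * (2 * x) := by
  have hpi := Real.pi_pos
  have hpi3 := Real.pi_gt_three
  have hx2 : x ^ 2 ≤ 9 / 100 := by nlinarith
  have hsqrt : Real.sqrt (1 - x ^ 2) ≤ 1 :=
    Real.sqrt_le_one.mpr (by nlinarith)
  calc K0 x ≤ 6 / Real.pi * x * 1 + 2 / Real.pi * (1 + 2 * x ^ 2) * (x + x ^ 3 / 2) := by
        unfold K0
        gcongr
        exact arcsin_le_add_cube h0 h1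
    _ = 4 / Real.pi * (2 * x) + (5 + 2 * x ^ 2) * x ^ 2 * x / Real.pi := by
        field_simp
        ring
    _ ≤ 4 / Real.pi * (2 * x) + 1 / 10 * (2 * x) := by
        gcongr
        rw [div_le_iff₀ hpi]
        have hq : (5 + 2 * x ^ 2) * x ^ 2 ≤ 3 / 5 := by nlinarith [sq_nonneg x]
        nlinarith [mul_le_mul_of_nonneg_right hq h0, mul_le_mul_of_nonneg_left hpi3.le h0]
    _ = (4 / Real.pi + 1 / 10) * (2 * x) := by ring

theorem gam_succ (i : ℕ) :
    gam (i + 1) = 2 * Real.sqrt (i + 1) - Real.sqrt i - Real.sqrt (i + 2) := by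
  unfold gam
  push_cast
  ring_nf

theorem gam_succ_pos (i : ℕ) : 0 < gam (i + 1) := by
  rw [gam_succ]
  have hi : (0 : ℝ) ≤ i := i.cast_nonneg
  have ha := Real.sq_sqrt hi
  have hb := Real.sq_sqrt (by linarith : (0 : ℝ) ≤ i + 1)
  have hc := Real.sq_sqrt (by linarith : (0 : ℝ) ≤ i + 2)
  have hlt : Real.sqrt i < Real.sqrt (i + 2) := Real.sqrt_lt_sqrt hi (by linarith)
  have hb0 := Real.sqrt_nonneg ((i : ℝ) + 1)
  have hsq : (Real.sqrt i + Real.sqrt (i + 2)) ^ 2 < (2 * Real.sqrt (i + 1)) ^ 2 := by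
    nlinarith [mul_pos (sub_pos.mpr hlt) (sub_pos.mpr hlt)]
  linarith [lt_of_pow_lt_pow_left₀ 2 (by positivity) hsq]

theorem gam_succ_le (i : ℕ) : gam (i + 1) ≤ 3 / 5 := by
  rw [gam_succ]
  have h2 : (7 / 5 : ℝ) ≤ Real.sqrt 2 := Real.le_sqrt_of_sq_le (by norm_num)
  rcases i.eq_zero_or_pos with rfl | hi
  · norm_num
    linarith
  have hi1 : (1 : ℝ) ≤ i := by exact_mod_cast hi
  have h1 : 1 ≤ Real.sqrt i := Real.one_le_sqrt.mpr hi1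
  have hstep : Real.sqrt ((i : ℝ) + 1) ≤ Real.sqrt i + 3 / 5 :=
    Real.sqrt_le_iff.mpr ⟨by positivity, by nlinarith [Real.sq_sqrt (zero_le_one.trans hi1)]⟩
  have hmono : Real.sqrt ((i : ℝ) + 1) ≤ Real.sqrt (i + 2) := Real.sqrt_le_sqrt (by linarith)
  linarith

theorem sum_range_gam_succ (n : ℕ) :
    ∑ i ∈ Finset.range n, gam (i + 1) = 1 - (Real.sqrt (n + 1) - Real.sqrt n) := by
  induction n with
  | zero => simp
  | succ n ih =>
    rw [Finset.sum_range_succ, ih, gam_succ]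
    push_cast
    ring_nf

theorem sum_range_K0_gam_le (n : ℕ) :
    ∑ i ∈ Finset.range n, K0 (gam (i + 1) / 2) ≤ 4 / Real.pi + 1 / 10 := by
  have hpi := Real.pi_pos
  calc ∑ i ∈ Finset.range n, K0 (gam (i + 1) / 2)
      ≤ ∑ i ∈ Finset.range n, (4 / Real.pi + 1 / 10) * gam (i + 1) := by
        gcongr with i
        have h := K0_le_linear (x := gam (i + 1) / 2)
          (by linarith [gam_succ_pos i]) (by linarith [gam_succ_le i])
        rwa [mul_div_cancel₀ _ two_ne_zero] at h
    _ = (4 / Real.pi + 1 / 10) * ∑ i ∈ Finset.range n, gam (i + 1) := by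
        rw [Finset.mul_sum]
    _ ≤ 4 / Real.pi + 1 / 10 := by
        refine mul_le_of_le_one_right (by positivity) ?_
        rw [sum_range_gam_succ]
        linarith [Real.sqrt_le_sqrt (by linarith : (n : ℝ) ≤ n + 1)]

/-- The series `∑_{i=1}^∞ K₀(γ_i/2)` converges, its sum lies in
`(0, 4/π + 9√2/112]`, the latter bound is `< 3/2`, and consequently
`κ² = 6/π − (4/π)∑_{i=1}^∞ K₀(γ_i/2) > 0`. -/
theorem K0_series_bounds :
    Summable (fun i : ℕ => K0 (gam (i + 1) / 2)) ∧
    0 < ∑' i : ℕ, K0 (gam (i + 1) / 2) ∧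
    (∑' i : ℕ, K0 (gam (i + 1) / 2)) ≤ 4 / Real.pi + 9 * Real.sqrt 2 / 112 ∧
    4 / Real.pi + 9 * Real.sqrt 2 / 112 < 3 / 2 ∧
    0 < 6 / Real.pi - 4 / Real.pi * ∑' i : ℕ, K0 (gam (i + 1) / 2) := by
  have hpi := Real.pi_pos
  have hpos (i : ℕ) : 0 < K0 (gam (i + 1) / 2) := K0_pos (half_pos (gam_succ_pos i))
  have hsum : Summable (fun i : ℕ => K0 (gam (i + 1) / 2)) :=
    summable_of_sum_range_le (fun i => (hpos i).le) sum_range_K0_gam_le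
  have hle : ∑' i : ℕ, K0 (gam (i + 1) / 2) ≤ 4 / Real.pi + 1 / 10 :=
    Real.tsum_le_of_sum_range_le (fun i => (hpos i).le) sum_range_K0_gam_le
  have hsqrt_ge : (7 / 5 : ℝ) ≤ Real.sqrt 2 := Real.le_sqrt_of_sq_le (by norm_num)
  have hsqrt_le : Real.sqrt 2 ≤ 3 / 2 := Real.sqrt_le_iff.mpr (by norm_num)
  have hpi_inv : 4 / Real.pi < 13 / 10 := by
    rw [div_lt_iff₀ hpi]
    linarith [Real.pi_gt_d2]
  have hS : ∑' i : ℕ, K0 (gam (i + 1) / 2) < 3 / 2 := by linarith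
  refine ⟨hsum, hsum.tsum_pos (fun i => (hpos i).le) 0 (hpos 0), by linarith, by linarith, ?_⟩
  have h := mul_lt_mul_of_pos_left hS (by positivity : 0 < 4 / Real.pi)
  have h6 : 4 / Real.pi * (3 / 2) = 6 / Real.pi := by ring
  linarith
end

section
/- Let F be the centered Gaussian process with covariance E[F(s)F(t)] = (2π)^{-1/2}(√(t+s) − √|t−s|). For n ≥ 1 let ΔF_j = F(j/n) − F((j−1)/n). Then for all 0 ≤ s < t, lim_{n→∞} E | ∑_{j=⌊ns⌋+1}^{⌊nt⌋} ΔF_j · |ΔF_j| |² = κ² (t − s), where κ² = 6/π − (4/π) ∑_{i=1}^∞ K₀(γ_i/2). (This is the variance limit underlying the convergence of the signed quadratic variation ∑ ΔF_j² sgn(ΔF_j) to κ times a Brownian motion independent of F.) -/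
open MeasureTheory ProbabilityTheory Filter

theorem integral_cos_sq_mul_cos_sub_sq (φ a b : ℝ) :
    ∫ θ in a..b, Real.cos θ ^ 2 * Real.cos (θ - φ) ^ 2 =
      ((Real.cos φ ^ 2 + 1 / 2) * b + Real.cos φ * Real.sin (2 * b - φ)
        + Real.sin (4 * b - 2 * φ) / 8) / 4
      - ((Real.cos φ ^ 2 + 1 / 2) * a + Real.cos φ * Real.sin (2 * a - φ)
        + Real.sin (4 * a - 2 * φ) / 8) / 4 := by
  refine intervalIntegral.integral_eq_sub_of_hasDerivAt
    (f := fun x => ((Real.cos φ ^ 2 + 1 / 2) * x + Real.cos φ * Real.sin (2 * x - φ)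
        + Real.sin (4 * x - 2 * φ) / 8) / 4) (fun x _ => ?_)
    ((by fun_prop : Continuous _).intervalIntegrable _ _)
  have h1 : HasDerivAt (fun x : ℝ => Real.sin (2 * x - φ)) (Real.cos (2 * x - φ) * 2) x := by
    simpa using (((hasDerivAt_id x).const_mul 2).sub_const φ).sin
  have h2 : HasDerivAt (fun x : ℝ => Real.sin (4 * x - 2 * φ))
      (Real.cos (4 * x - 2 * φ) * 4) x := by
    simpa using (((hasDerivAt_id x).const_mul 4).sub_const (2 * φ)).sin
  have h := ((((hasDerivAt_id x).const_mul (Real.cos φ ^ 2 + 1 / 2)).add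
    (h1.const_mul (Real.cos φ))).add (h2.div_const 8)).div_const 4
  refine h.congr_deriv ?_
  have e1 : 2 * (Real.cos x * Real.cos (x - φ)) = Real.cos (2 * x - φ) + Real.cos φ := by
    have e := Real.cos_add x (x - φ)
    have e' := Real.cos_sub x (x - φ)
    rw [show x + (x - φ) = 2 * x - φ by ring] at e
    rw [show x - (x - φ) = φ by ring] at e'
    linarith
  have e2 : Real.cos (4 * x - 2 * φ) = 2 * Real.cos (2 * x - φ) ^ 2 - 1 := by
    rw [← Real.cos_two_mul]; ring_nf
  rw [e2, ← mul_pow, show Real.cos x * Real.cos (x - φ)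
    = (Real.cos (2 * x - φ) + Real.cos φ) / 2 by linarith]
  ring

theorem integral_signed_sq_cos (φ : ℝ) (h0 : 0 ≤ φ) (h1 : φ ≤ Real.pi) :
    ∫ θ in -Real.pi..Real.pi, (Real.cos θ * |Real.cos θ|) *
        (Real.cos (θ - φ) * |Real.cos (θ - φ)|) = Real.pi / 4 * K0 (Real.cos φ) := by
  set f : ℝ → ℝ := fun θ => (Real.cos θ * |Real.cos θ|) *
        (Real.cos (θ - φ) * |Real.cos (θ - φ)|) with hf
  have hc : Continuous f := by fun_prop
  have hi : ∀ a b, IntervalIntegrable f volume a b := fun a b => hc.intervalIntegrable a b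
  have hp : Function.Periodic f Real.pi := by
    intro x
    simp only [hf]
    rw [show x + Real.pi - φ = (x - φ) + Real.pi by ring, Real.cos_add_pi, Real.cos_add_pi,
      abs_neg, abs_neg]
    ring
  have e0 := hp.intervalIntegral_add_eq (-Real.pi) (φ - Real.pi / 2)
  have e1 := hp.intervalIntegral_add_eq 0 (φ - Real.pi / 2)
  rw [neg_add_cancel] at e0
  rw [zero_add] at e1
  rw [← intervalIntegral.integral_add_adjacent_intervals (hi (-Real.pi) 0) (hi 0 Real.pi), e0, e1,
    ← intervalIntegral.integral_add_adjacent_intervals (hi (φ - Real.pi / 2) (Real.pi / 2))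
      (hi (Real.pi / 2) _)]
  have hpi := Real.pi_pos
  have ea : ∫ θ in (φ - Real.pi / 2)..(Real.pi / 2), f θ =
      ∫ θ in (φ - Real.pi / 2)..(Real.pi / 2), Real.cos θ ^ 2 * Real.cos (θ - φ) ^ 2 := by
    refine intervalIntegral.integral_congr fun θ hθ => ?_
    rw [Set.uIcc_of_le (by linarith)] at hθ
    have c1 : 0 ≤ Real.cos θ := Real.cos_nonneg_of_mem_Icc ⟨by linarith [hθ.1], hθ.2⟩
    have c2 : 0 ≤ Real.cos (θ - φ) :=
      Real.cos_nonneg_of_mem_Icc ⟨by linarith [hθ.1], by linarith [hθ.2]⟩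
    simp only [hf, abs_of_nonneg c1, abs_of_nonneg c2]
    ring
  have eb : ∫ θ in (Real.pi / 2)..(φ - Real.pi / 2 + Real.pi), f θ =
      -∫ θ in (Real.pi / 2)..(φ - Real.pi / 2 + Real.pi),
        Real.cos θ ^ 2 * Real.cos (θ - φ) ^ 2 := by
    rw [← intervalIntegral.integral_neg]
    refine intervalIntegral.integral_congr fun θ hθ => ?_
    rw [Set.uIcc_of_le (by linarith)] at hθ
    have c1 : Real.cos θ ≤ 0 :=
      Real.cos_nonpos_of_pi_div_two_le_of_le hθ.1 (by linarith [hθ.2])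
    have c2 : 0 ≤ Real.cos (θ - φ) :=
      Real.cos_nonneg_of_mem_Icc ⟨by linarith [hθ.1], by linarith [hθ.2]⟩
    simp only [hf, abs_of_nonpos c1, abs_of_nonneg c2]
    ring
  rw [ea, eb, integral_cos_sq_mul_cos_sub_sq, integral_cos_sq_mul_cos_sub_sq]
  have s1 : Real.sin (2 * (Real.pi / 2) - φ) = Real.sin φ := by
    rw [show 2 * (Real.pi / 2) - φ = Real.pi - φ by ring, Real.sin_pi_sub]
  have s2 : Real.sin (2 * (φ - Real.pi / 2) - φ) = -Real.sin φ := by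
    rw [show 2 * (φ - Real.pi / 2) - φ = φ - Real.pi by ring, Real.sin_sub_pi]
  have s3 : Real.sin (2 * (φ - Real.pi / 2 + Real.pi) - φ) = -Real.sin φ := by
    rw [show 2 * (φ - Real.pi / 2 + Real.pi) - φ = φ + Real.pi by ring, Real.sin_add_pi]
  have s4 : Real.sin (4 * (Real.pi / 2) - 2 * φ) = -Real.sin (2 * φ) := by
    rw [show 4 * (Real.pi / 2) - 2 * φ = 2 * Real.pi - 2 * φ by ring, Real.sin_two_pi_sub]
  have s5 : Real.sin (4 * (φ - Real.pi / 2) - 2 * φ) = Real.sin (2 * φ) := by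
    rw [show 4 * (φ - Real.pi / 2) - 2 * φ = 2 * φ - 2 * Real.pi by ring, Real.sin_sub_two_pi]
  have s6 : Real.sin (4 * (φ - Real.pi / 2 + Real.pi) - 2 * φ) = Real.sin (2 * φ) := by
    rw [show 4 * (φ - Real.pi / 2 + Real.pi) - 2 * φ = 2 * φ + 2 * Real.pi by ring,
      Real.sin_add_two_pi]
  rw [s1, s2, s3, s4, s5, s6, K0, Real.sin_two_mul]
  have hs : Real.sqrt (1 - Real.cos φ ^ 2) = Real.sin φ := by
    rw [← Real.abs_sin_eq_sqrt_one_sub_cos_sq,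
      abs_of_nonneg (Real.sin_nonneg_of_nonneg_of_le_pi h0 h1)]
  have ha : Real.arcsin (Real.cos φ) = Real.pi / 2 - φ := by
    rw [Real.arcsin_eq_pi_div_two_sub_arccos, Real.arccos_cos h0 h1]
  rw [hs, ha]
  field_simp
  ring

theorem integral_pow_five_mul_exp_neg_half_sq :
    ∫ r in Set.Ioi (0 : ℝ), r ^ 5 * Real.exp (-(1 / 2) * r ^ 2) = 8 := by
  have h := integral_rpow_mul_exp_neg_mul_rpow (p := 2) (q := 5) (b := 1 / 2)
    (by norm_num) (by norm_num) (by norm_num)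
  have h3 : Real.Gamma ((5 + 1) / 2) = 2 := by
    rw [show ((5 : ℝ) + 1) / 2 = (2 : ℕ) + 1 by norm_num, Real.Gamma_nat_eq_factorial]
    norm_num
  have h4 : (1 / 2 : ℝ) ^ (-(5 + 1) / 2 : ℝ) = 8 := by
    rw [show (-(5 + 1) / 2 : ℝ) = ((-3 : ℤ) : ℝ) by norm_num, Real.rpow_intCast]
    norm_num
  rw [h3, h4] at h
  norm_num at h
  rw [← h]
  norm_num

/-- The signed second moment `E[X|X| Y|Y|]` for standard normal `X`, `Y` with correlation
`cos φ`. -/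
theorem integral_stdGaussian_prod_signed_sq (φ : ℝ) (h0 : 0 ≤ φ) (h1 : φ ≤ Real.pi) :
    ∫ z : ℝ × ℝ, (z.1 * |z.1|) * ((Real.cos φ * z.1 + Real.sin φ * z.2) *
        |Real.cos φ * z.1 + Real.sin φ * z.2|) ∂((gaussianReal 0 1).prod (gaussianReal 0 1)) =
      K0 (Real.cos φ) := by
  rw [gaussianReal_of_var_ne_zero 0 one_ne_zero, prod_withDensity (measurable_gaussianPDF _ _)
    (measurable_gaussianPDF _ _), integral_withDensity_eq_integral_toReal_smul
    (by have := measurable_gaussianPDF 0 1; fun_prop)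
    (ae_of_all _ fun z => ENNReal.mul_lt_top gaussianPDF_lt_top gaussianPDF_lt_top),
    ← Measure.volume_eq_prod, ← integral_comp_polarCoord_symm, polarCoord_target]
  have : ∀ p ∈ Set.Ioi (0 : ℝ) ×ˢ Set.Ioo (-Real.pi) Real.pi,
      p.1 • ((gaussianPDF 0 1 (polarCoord.symm p).1 * gaussianPDF 0 1 (polarCoord.symm p).2).toReal •
        (((polarCoord.symm p).1 * |(polarCoord.symm p).1|) *
          ((Real.cos φ * (polarCoord.symm p).1 + Real.sin φ * (polarCoord.symm p).2) *
        |Real.cos φ * (polarCoord.symm p).1 + Real.sin φ * (polarCoord.symm p).2|))) =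
      (p.1 ^ 5 * Real.exp (-(1 / 2) * p.1 ^ 2)) * ((2 * Real.pi)⁻¹ *
        ((Real.cos p.2 * |Real.cos p.2|) *
        (Real.cos (p.2 - φ) * |Real.cos (p.2 - φ)|))) := by
    rintro ⟨r, θ⟩ ⟨hr, -⟩
    have hr : 0 < r := hr
    simp only [polarCoord_symm_apply, ENNReal.toReal_mul, toReal_gaussianPDF, gaussianPDFReal,
      smul_eq_mul]
    rw [show Real.cos φ * (r * Real.cos θ) + Real.sin φ * (r * Real.sin θ) =
      r * Real.cos (θ - φ) by rw [Real.cos_sub]; ring, abs_mul, abs_mul, abs_of_pos hr]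
    have e : Real.exp (-(1 / 2) * r ^ 2) = Real.exp (-(r * Real.cos θ - 0) ^ 2 / (2 * (1 : NNReal)))
        * Real.exp (-(r * Real.sin θ - 0) ^ 2 / (2 * (1 : NNReal))) := by
      rw [← Real.exp_add]
      congr 1
      simp only [NNReal.coe_one]
      linear_combination (1 / 2) * r ^ 2 * Real.sin_sq_add_cos_sq θ
    have e2 : (Real.sqrt (2 * Real.pi * (1 : NNReal)))⁻¹ *
        (Real.sqrt (2 * Real.pi * (1 : NNReal)))⁻¹
        = (2 * Real.pi)⁻¹ := by
      rw [← mul_inv, Real.mul_self_sqrt (by positivity)]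
      simp
    rw [e, ← e2]
    ring
  rw [setIntegral_congr_fun (measurableSet_Ioi.prod measurableSet_Ioo) this,
    Measure.volume_eq_prod, setIntegral_prod_mul (fun r : ℝ => r ^ 5 * Real.exp (-(1 / 2) * r ^ 2))
      (fun θ : ℝ => (2 * Real.pi)⁻¹ * ((Real.cos θ * |Real.cos θ|) *
        (Real.cos (θ - φ) * |Real.cos (θ - φ)|))),
    integral_pow_five_mul_exp_neg_half_sq, integral_const_mul, ← integral_Ioc_eq_integral_Ioo,
    ← intervalIntegral.integral_of_le (by linarith [Real.pi_pos]), integral_signed_sq_cos φ h0 h1]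
  have := Real.pi_pos.ne'
  field_simp
  norm_num

theorem map_stdGaussian_prod_linear (a b : ℝ) :
    ((gaussianReal 0 1).prod (gaussianReal 0 1)).map (fun z : ℝ × ℝ => a * z.1 + b * z.2) =
      gaussianReal 0 (Real.toNNReal (a ^ 2 + b ^ 2)) := by
  set μ := (gaussianReal 0 1).prod (gaussianReal 0 1)
  have hind : IndepFun (fun z : ℝ × ℝ => a * z.1) (fun z : ℝ × ℝ => b * z.2) μ :=
    indepFun_prod (by fun_prop : Measurable fun x : ℝ => a * x)
      (by fun_prop : Measurable fun x : ℝ => b * x)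
  have h1 : μ.map (fun z : ℝ × ℝ => a * z.1) = gaussianReal (a * 0) (.mk (a ^ 2) (sq_nonneg a) * 1) := by
    rw [← gaussianReal_map_const_mul, ← Measure.fst_prod (μ := gaussianReal 0 1) (ν := gaussianReal 0 1),
      Measure.fst, Measure.map_map (by fun_prop) (by fun_prop)]
    rfl
  have h2 : μ.map (fun z : ℝ × ℝ => b * z.2) = gaussianReal (b * 0) (.mk (b ^ 2) (sq_nonneg b) * 1) := by
    rw [← gaussianReal_map_const_mul, ← Measure.snd_prod (μ := gaussianReal 0 1) (ν := gaussianReal 0 1),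
      Measure.snd, Measure.map_map (by fun_prop) (by fun_prop)]
    rfl
  have h := gaussianReal_add_gaussianReal_of_indepFun hind h1 h2
  rw [show (fun z : ℝ × ℝ => a * z.1 + b * z.2) =
    (fun z : ℝ × ℝ => a * z.1) + (fun z : ℝ × ℝ => b * z.2) from rfl, h]
  congr 1
  · simp
  · ext
    rw [Real.coe_toNNReal _ (by positivity)]
    simp

section BivariateGaussian

variable {Ω : Type*} [MeasurableSpace Ω] {P : Measure Ω} {X Y : Ω → ℝ}

theorem map_prodMk_eq_of_forall_linear [IsFiniteMeasure P] (hX : Measurable X) (hY : Measurable Y)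
    {ν : Measure (ℝ × ℝ)} [IsFiniteMeasure ν]
    (h : ∀ a b : ℝ, P.map (fun ω => a * X ω + b * Y ω) =
      ν.map (fun z : ℝ × ℝ => a * z.1 + b * z.2)) :
    P.map (fun ω => (X ω, Y ω)) = ν := by
  refine Measure.ext_of_charFunDual (funext fun L => ?_)
  have hL : (L : ℝ × ℝ → ℝ) = fun z => L (1, 0) * z.1 + L (0, 1) * z.2 := by
    funext z
    have : z = z.1 • ((1, 0) : ℝ × ℝ) + z.2 • ((0, 1) : ℝ × ℝ) := by ext <;> simp
    conv_lhs => rw [this, map_add, map_smul, map_smul]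
    simp only [smul_eq_mul]
    ring
  rw [charFunDual_eq_charFun_map_one, charFunDual_eq_charFun_map_one,
    Measure.map_map (by fun_prop) (by fun_prop), hL, ← h]
  rfl

/-- If every `a X + b Y` is centered Gaussian with variance `a² A + 2 a b B + b² C`, then
`E[X|X| Y|Y|] = A C K₀(B / √(A C))`. -/
theorem integral_signed_sq_mul_signed_sq [IsFiniteMeasure P] (hX : Measurable X) (hY : Measurable Y)
    {A B C : ℝ} (hA : 0 < A) (hC : 0 < C) (hB : |B| ≤ Real.sqrt A * Real.sqrt C)
    (h : ∀ a b : ℝ, P.map (fun ω => a * X ω + b * Y ω) =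
      gaussianReal 0 (Real.toNNReal (a ^ 2 * A + 2 * a * b * B + b ^ 2 * C))) :
    ∫ ω, (X ω * |X ω|) * (Y ω * |Y ω|) ∂P =
      A * C * K0 (B / (Real.sqrt A * Real.sqrt C)) := by
  have hA' := Real.sqrt_pos.2 hA
  have hC' := Real.sqrt_pos.2 hC
  set ρ := B / (Real.sqrt A * Real.sqrt C) with hρ
  have hρ1 : |ρ| ≤ 1 := by
    rw [hρ, abs_div, abs_of_pos (mul_pos hA' hC')]
    exact (div_le_one (mul_pos hA' hC')).2 hB
  obtain ⟨l, u⟩ := abs_le.1 hρ1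
  set φ := Real.arccos ρ
  have hcos : Real.cos φ = ρ := Real.cos_arccos l u
  set T : ℝ × ℝ → ℝ × ℝ := fun z =>
    (Real.sqrt A * z.1, Real.sqrt C * (Real.cos φ * z.1 + Real.sin φ * z.2)) with hT
  have hTm : Measurable T := by fun_prop
  have hlaw : P.map (fun ω => (X ω, Y ω)) =
      ((gaussianReal 0 1).prod (gaussianReal 0 1)).map T := by
    refine map_prodMk_eq_of_forall_linear hX hY fun a b => ?_
    rw [h, Measure.map_map (by fun_prop) hTm]
    have : (fun z : ℝ × ℝ => a * z.1 + b * z.2) ∘ T = fun z : ℝ × ℝ =>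
        (a * Real.sqrt A + b * Real.sqrt C * Real.cos φ) * z.1 +
          (b * Real.sqrt C * Real.sin φ) * z.2 := by
      funext z
      simp only [hT, Function.comp]
      ring
    rw [this, map_stdGaussian_prod_linear]
    congr 2
    have eB : B = Real.sqrt A * Real.sqrt C * Real.cos φ := by
      rw [hcos, hρ]; field_simp
    have eA := Real.sq_sqrt hA.le
    have eC := Real.sq_sqrt hC.le
    rw [eB]
    linear_combination (-a ^ 2) * eA - b ^ 2 * eC -
      b ^ 2 * Real.sqrt C ^ 2 * Real.sin_sq_add_cos_sq φ
  have e1 : ∫ ω, (X ω * |X ω|) * (Y ω * |Y ω|) ∂P =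
      ∫ z : ℝ × ℝ, (z.1 * |z.1|) * (z.2 * |z.2|) ∂(P.map (fun ω => (X ω, Y ω))) := by
    rw [integral_map (by fun_prop)
      (by fun_prop : Continuous _).aestronglyMeasurable]
  rw [e1, hlaw, integral_map hTm.aemeasurable (by fun_prop : Continuous _).aestronglyMeasurable,
    ← hcos, ← integral_stdGaussian_prod_signed_sq φ (Real.arccos_nonneg _) (Real.arccos_le_pi _),
    ← integral_const_mul]
  congr 1 with z
  simp only [hT, abs_mul, abs_of_pos hA', abs_of_pos hC']
  have eA := Real.mul_self_sqrt hA.le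
  have eC := Real.mul_self_sqrt hC.le
  linear_combination (z.1 * |z.1| * ((Real.cos φ * z.1 + Real.sin φ * z.2) *
    |Real.cos φ * z.1 + Real.sin φ * z.2|)) * (Real.sqrt C * Real.sqrt C * eA + A * eC)

theorem memLp_signed_sq_of_map_eq_gaussianReal (hX : Measurable X) {v : NNReal}
    (h : P.map X = gaussianReal 0 v) : MemLp (fun ω => X ω * |X ω|) 2 P := by
  have h4 : MemLp X 4 P := by
    have := memLp_id_gaussianReal' (μ := 0) (v := v) 4 (by norm_num)
    rw [← h] at this
    exact (memLp_map_measure_iff aestronglyMeasurable_id hX.aemeasurable).1 this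
  have : ENNReal.HolderTriple 4 4 2 := ⟨by
    rw [← two_mul, show (4 : ENNReal) = 2 * 2 by norm_num,
      ENNReal.mul_inv (by norm_num) (by norm_num), ← mul_assoc,
      ENNReal.mul_inv_cancel (by norm_num) (by norm_num), one_mul]⟩
  exact h4.abs.mul h4

end BivariateGaussian

/-- `√` has second difference `-sqrtDiff x` at `x`; at natural numbers this is `gam`. -/
noncomputable def sqrtDiff (x : ℝ) : ℝ :=
  2 * Real.sqrt x - Real.sqrt (x - 1) - Real.sqrt (x + 1)

theorem sqrtDiff_eq_two_div {x : ℝ} (hx : 1 ≤ x) :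
    sqrtDiff x = 2 / ((Real.sqrt (x + 1) + Real.sqrt (x - 1)) *
      (Real.sqrt x + Real.sqrt (x - 1)) * (Real.sqrt (x + 1) + Real.sqrt x)) := by
  have p := Real.sqrt_nonneg (x - 1)
  have q : 0 < Real.sqrt x := Real.sqrt_pos.2 (by linarith)
  have r : 0 < Real.sqrt (x + 1) := Real.sqrt_pos.2 (by linarith)
  have p2 := Real.sq_sqrt (show 0 ≤ x - 1 by linarith)
  have q2 := Real.sq_sqrt (show 0 ≤ x by linarith)
  have r2 := Real.sq_sqrt (show 0 ≤ x + 1 by linarith)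
  rw [sqrtDiff, eq_div_iff (by positivity)]
  set P := Real.sqrt (x - 1)
  set Q := Real.sqrt x
  set R := Real.sqrt (x + 1)
  have e1 : (Q - P) * (Q + P) = 1 := by linear_combination q2 - p2
  have e2 : (R - Q) * (R + Q) = 1 := by linear_combination r2 - q2
  have e3 : (R - P) * (R + P) = 2 := by linear_combination r2 - p2
  linear_combination (R + P) * (R + Q) * e1 - (R + P) * (Q + P) * e2 + e3

theorem sqrtDiff_nonneg {x : ℝ} (hx : 1 ≤ x) : 0 ≤ sqrtDiff x := by
  rw [sqrtDiff_eq_two_div hx]; positivity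

theorem sqrtDiff_le_sqrtDiff {x y : ℝ} (hx : 1 ≤ x) (hxy : x ≤ y) :
    sqrtDiff y ≤ sqrtDiff x := by
  have q : 0 < Real.sqrt x := Real.sqrt_pos.2 (by linarith)
  rw [sqrtDiff_eq_two_div hx, sqrtDiff_eq_two_div (hx.trans hxy)]
  gcongr

theorem sqrtDiff_le {x : ℝ} (hx : 1 ≤ x) : sqrtDiff x ≤ 2 - Real.sqrt 2 := by
  have h := sqrtDiff_le_sqrtDiff le_rfl hx
  have : sqrtDiff 1 = 2 - Real.sqrt 2 := by
    rw [sqrtDiff]; norm_num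
  linarith

theorem tendsto_sqrtDiff_atTop : Tendsto sqrtDiff atTop (nhds 0) := by
  have h : Tendsto (fun x : ℝ => 2 / Real.sqrt x) atTop (nhds 0) :=
    tendsto_const_nhds.div_atTop Real.tendsto_sqrt_atTop
  refine squeeze_zero' ?_ ?_ h
  · filter_upwards [eventually_ge_atTop 1] with x hx using sqrtDiff_nonneg hx
  · filter_upwards [eventually_ge_atTop 1] with x hx
    have q : 1 ≤ Real.sqrt x := Real.one_le_sqrt.2 hx
    have r : 1 ≤ Real.sqrt (x + 1) := Real.one_le_sqrt.2 (by linarith)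
    have p := Real.sqrt_nonneg (x - 1)
    rw [sqrtDiff_eq_two_div hx]
    gcongr
    calc Real.sqrt x = 1 * 1 * Real.sqrt x := by ring
      _ ≤ _ := by gcongr <;> linarith

theorem summable_sqrtDiff : Summable fun k : ℕ => sqrtDiff (k + 1) := by
  refine summable_of_sum_range_le (c := 1) (fun k => sqrtDiff_nonneg (by simp)) fun n => ?_
  have h : ∀ n : ℕ, ∑ k ∈ Finset.range n, sqrtDiff (k + 1) =
      1 - (Real.sqrt (n + 1) - Real.sqrt n) := by
    intro n
    induction n with
    | zero => simp
    | succ n ih =>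
      rw [Finset.sum_range_succ, ih, sqrtDiff]
      push_cast
      ring_nf
  rw [h]
  have := Real.sqrt_le_sqrt (show (n : ℝ) ≤ n + 1 by linarith)
  linarith

theorem K0_neg (x : ℝ) : K0 (-x) = -K0 x := by
  simp only [K0, Real.arcsin_neg, neg_sq]
  ring

theorem K0_one : K0 1 = 3 := by
  have := Real.pi_pos.ne'
  simp only [K0, Real.arcsin_one]
  norm_num
  field_simp

theorem continuous_K0 : Continuous K0 := by
  unfold K0
  fun_prop

theorem abs_arcsin_le {x : ℝ} (hx : |x| ≤ 1) : |Real.arcsin x| ≤ Real.pi / 2 * |x| := by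
  have key : ∀ y : ℝ, 0 ≤ y → y ≤ 1 → Real.arcsin y ≤ Real.pi / 2 * y := by
    intro y h0 h1
    have h := Real.mul_le_sin (Real.arcsin_nonneg.2 h0) (Real.arcsin_le_pi_div_two y)
    rw [Real.sin_arcsin (by linarith) h1] at h
    have := Real.pi_pos
    calc Real.arcsin y = Real.pi / 2 * (2 / Real.pi * Real.arcsin y) := by field_simp
      _ ≤ _ := by gcongr
  rcases le_total 0 x with h | h
  · rw [abs_of_nonneg h] at hx ⊢
    rw [abs_of_nonneg (Real.arcsin_nonneg.2 h)]
    exact key x h hx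
  · rw [abs_of_nonpos h] at hx ⊢
    rw [abs_of_nonpos (Real.arcsin_nonpos.2 h), ← Real.arcsin_neg]
    exact key (-x) (by linarith) hx

theorem abs_K0_le {x : ℝ} (hx : |x| ≤ 1) : |K0 x| ≤ 5 * |x| := by
  have hpi := Real.pi_pos
  have h6 : 6 / Real.pi ≤ 2 := by
    rw [div_le_iff₀ hpi]; linarith [Real.pi_gt_three]
  have hs : Real.sqrt (1 - x ^ 2) ≤ 1 :=
    Real.sqrt_le_iff.2 ⟨zero_le_one, by nlinarith [sq_nonneg x]⟩
  have hx2 : x ^ 2 ≤ 1 := (sq_le_one_iff_abs_le_one x).2 hx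
  have hx0 := abs_nonneg x
  calc |K0 x| ≤ |6 / Real.pi * x * Real.sqrt (1 - x ^ 2)| +
        |2 / Real.pi * (1 + 2 * x ^ 2) * Real.arcsin x| := abs_add_le _ _
    _ = 6 / Real.pi * |x| * Real.sqrt (1 - x ^ 2) +
        2 / Real.pi * (1 + 2 * x ^ 2) * |Real.arcsin x| := by
      rw [abs_mul, abs_mul, abs_mul, abs_of_nonneg (Real.sqrt_nonneg _),
        abs_of_pos (by positivity : 0 < 6 / Real.pi),
        abs_of_pos (by positivity : 0 < 2 / Real.pi * (1 + 2 * x ^ 2))]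
    _ ≤ 2 * |x| * 1 + 2 / Real.pi * (1 + 2 * 1) * (Real.pi / 2 * |x|) := by
      gcongr
      exact abs_arcsin_le hx
    _ = 5 * |x| := by field_simp; norm_num

theorem sum_sum_Ioc_of_symm (a b : ℕ) (M : ℕ → ℕ → ℝ) (hM : ∀ i j, M i j = M j i) :
    ∑ i ∈ Finset.Ioc a b, ∑ j ∈ Finset.Ioc a b, M i j =
      ∑ i ∈ Finset.Ioc a b, M i i +
        2 * ∑ i ∈ Finset.Ioc a b, ∑ k ∈ Finset.range (b - i), M i (i + 1 + k) := by
  have h1 : ∀ i j, M i j = (if i = j then M i j else 0) + (if i < j then M i j else 0) +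
      (if j < i then M i j else 0) := by
    intro i j
    rcases lt_trichotomy i j with h | h | h
    · simp [h, h.ne, h.not_gt]
    · simp [h]
    · simp [h, h.ne', h.not_gt]
  have h2 : ∀ i ∈ Finset.Ioc a b, ∑ j ∈ Finset.Ioc a b, (if i < j then M i j else 0) =
      ∑ k ∈ Finset.range (b - i), M i (i + 1 + k) := by
    intro i hi
    rw [Finset.mem_Ioc] at hi
    rw [← Finset.sum_filter, show b - i = b + 1 - (i + 1) by omega,
      ← Finset.sum_Ico_eq_sum_range (fun j => M i j)]
    refine Finset.sum_congr ?_ fun _ _ => rfl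
    ext j
    simp only [Finset.mem_filter, Finset.mem_Ioc, Finset.mem_Ico]
    omega
  have h3 : ∑ i ∈ Finset.Ioc a b, ∑ j ∈ Finset.Ioc a b, (if j < i then M i j else 0) =
      ∑ i ∈ Finset.Ioc a b, ∑ j ∈ Finset.Ioc a b, (if i < j then M i j else 0) := by
    rw [Finset.sum_comm]
    simp_rw [fun i j => hM i j]
  have h4 : ∑ i ∈ Finset.Ioc a b, ∑ j ∈ Finset.Ioc a b, (if i = j then M i j else 0) =
      ∑ i ∈ Finset.Ioc a b, M i i := by
    refine Finset.sum_congr rfl fun i hi => ?_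
    rw [Finset.sum_ite_eq, if_pos hi]
  calc ∑ i ∈ Finset.Ioc a b, ∑ j ∈ Finset.Ioc a b, M i j =
      ∑ i ∈ Finset.Ioc a b, ∑ j ∈ Finset.Ioc a b, (if i = j then M i j else 0) +
      ∑ i ∈ Finset.Ioc a b, ∑ j ∈ Finset.Ioc a b, (if i < j then M i j else 0) +
      ∑ i ∈ Finset.Ioc a b, ∑ j ∈ Finset.Ioc a b, (if j < i then M i j else 0) := by
        simp_rw [← Finset.sum_add_distrib, ← h1]
    _ = _ := by
      rw [h3, h4, Finset.sum_congr rfl h2]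
      ring

/-- Block averages over `(a n, b n]` of a convergent sequence, when `a n ~ s n`, `b n ~ t n`. -/
theorem tendsto_div_mul_sum_Ioc {a b : ℕ → ℕ} {s t : ℝ}
    (ha : Tendsto (fun n => (a n : ℝ) / n) atTop (nhds s))
    (hb : Tendsto (fun n => (b n : ℝ) / n) atTop (nhds t))
    (hab : ∀ᶠ n in atTop, a n ≤ b n) {u : ℕ → ℝ} {l : ℝ} (hu : Tendsto u atTop (nhds l)) :
    Tendsto (fun n : ℕ => 1 / (n : ℝ) * ∑ i ∈ Finset.Ioc (a n) (b n), u i) atTop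
      (nhds ((t - s) * l)) := by
  have hc : Tendsto (fun i => |u i - l|) atTop (nhds 0) := by
    simpa using (hu.sub_const l).abs
  obtain ⟨m, hm⟩ := exists_nat_gt t
  have hces : Tendsto (fun n : ℕ => 1 / (n : ℝ) * ∑ i ∈ Finset.range (m * n + 1), |u i - l|) atTop
      (nhds 0) := by
    have h := hc.cesaro.comp (tendsto_atTop_mono (fun n => by
      show n ≤ (m + 1) * n + 1; nlinarith [Nat.zero_le (m * n)]) tendsto_id)
    have h' : Tendsto (fun n : ℕ => ((m : ℝ) + 2) * ((((m + 1) * n + 1 : ℕ) : ℝ)⁻¹ *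
        ∑ i ∈ Finset.range ((m + 1) * n + 1), |u i - l|)) atTop (nhds 0) := by
      simpa using h.const_mul ((m : ℝ) + 2)
    refine squeeze_zero' (.of_forall fun n => by positivity) ?_ h'
    filter_upwards [eventually_ge_atTop 1] with n hn
    have hn' : (1 : ℝ) ≤ n := by exact_mod_cast hn
    rw [← mul_assoc]
    gcongr
    · rw [← div_eq_mul_inv, div_le_div_iff₀ (by positivity) (by positivity)]
      push_cast
      nlinarith
    · omega
  have hdiff : Tendsto (fun n : ℕ => 1 / (n : ℝ) * ∑ i ∈ Finset.Ioc (a n) (b n), (u i - l)) atTop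
      (nhds 0) := by
    refine squeeze_zero_norm' ?_ hces
    filter_upwards [hb.eventually_lt_const hm, eventually_ge_atTop 1] with n hbn hn
    have hn' : (0 : ℝ) < n := by exact_mod_cast hn
    rw [div_lt_iff₀ hn'] at hbn
    have hbn' : b n < m * n := by exact_mod_cast hbn
    rw [norm_mul, Real.norm_of_nonneg (by positivity)]
    gcongr
    refine (norm_sum_le _ _).trans ?_
    refine Finset.sum_le_sum_of_subset_of_nonneg (fun i hi => ?_) fun _ _ _ => abs_nonneg _
    simp only [Finset.mem_Ioc, Finset.mem_range] at hi ⊢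
    omega
  have hmain : Tendsto (fun n : ℕ => ((b n : ℝ) / n - (a n : ℝ) / n) * l) atTop
      (nhds ((t - s) * l)) := (hb.sub ha).mul_const l
  have := hdiff.add hmain
  rw [zero_add] at this
  refine this.congr' ?_
  filter_upwards [hab] with n hn
  rw [Finset.sum_sub_distrib, Finset.sum_const, Nat.card_Ioc, nsmul_eq_mul, Nat.cast_sub hn]
  ring

theorem tendsto_div_mul_sum_diag_add_lags {a b : ℕ → ℕ} {s t : ℝ} (hst : s < t)
    (ha : Tendsto (fun n => (a n : ℝ) / n) atTop (nhds s))
    (hb : Tendsto (fun n => (b n : ℝ) / n) atTop (nhds t))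
    {D : ℕ → ℝ} {d : ℝ} (hD : Tendsto D atTop (nhds d))
    {O : ℕ → ℕ → ℝ} {o w : ℕ → ℝ} (hO : ∀ k, Tendsto (fun i => O i k) atTop (nhds (o k)))
    (hw : Summable w) (hOw : ∀ i k, 1 ≤ i → |O i k| ≤ w k) :
    Tendsto (fun n : ℕ => 1 / (n : ℝ) * (∑ i ∈ Finset.Ioc (a n) (b n), D i +
      2 * ∑ i ∈ Finset.Ioc (a n) (b n), ∑ k ∈ Finset.range (b n - i), O i k)) atTop
      (nhds ((d + 2 * ∑' k, o k) * (t - s))) := by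
  have hw0 : ∀ k, 0 ≤ w k := fun k => (abs_nonneg _).trans (hOw 1 k le_rfl)
  have hgap : ∀ k : ℕ, ∀ᶠ n in atTop, a n + k ≤ b n := by
    intro k
    have hk : Tendsto (fun n : ℕ => (a n : ℝ) / n + k / n) atTop (nhds s) := by
      simpa using ha.add (tendsto_const_div_atTop_nhds_zero_nat (k : ℝ))
    filter_upwards [hk.eventually_lt hb hst, eventually_ge_atTop 1] with n h hn
    have hn' : (0 : ℝ) < n := by exact_mod_cast hn
    rw [← add_div, div_lt_div_iff_of_pos_right hn'] at h
    exact_mod_cast h.le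
  have hdiag := tendsto_div_mul_sum_Ioc ha hb (by simpa using hgap 0) hD
  have hlag : ∀ k, Tendsto (fun n : ℕ => 1 / (n : ℝ) *
      ∑ i ∈ Finset.Ioc (a n) (b n - (k + 1)), O i k) atTop (nhds ((t - s) * o k)) := by
    intro k
    refine tendsto_div_mul_sum_Ioc ha ?_ ?_ (hO k)
    · have h := hb.sub (tendsto_const_div_atTop_nhds_zero_nat ((k : ℝ) + 1))
      rw [sub_zero] at h
      refine h.congr' ?_
      filter_upwards [hgap (k + 1)] with n hn
      rw [Nat.cast_sub (by omega)]
      push_cast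
      ring
    · filter_upwards [hgap (k + 1)] with n hn
      omega
  have htsum := tendsto_tsum_of_dominated_convergence (hw.mul_left (t + 1)) hlag (by
    filter_upwards [hb.eventually_le_const (lt_add_one t), eventually_ge_atTop 1] with n hbn hn k
    have hn' : (0 : ℝ) < n := by exact_mod_cast hn
    rw [norm_mul, Real.norm_of_nonneg (by positivity)]
    have h1 : ‖∑ i ∈ Finset.Ioc (a n) (b n - (k + 1)), O i k‖ ≤ b n * w k := by
      refine (norm_sum_le_of_le _ fun i hi => hOw i k ?_).trans ?_
      · rw [Finset.mem_Ioc] at hi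
        omega
      · rw [Finset.sum_const, Nat.card_Ioc, nsmul_eq_mul]
        have := hw0 k
        gcongr
        omega
    calc 1 / (n : ℝ) * ‖∑ i ∈ Finset.Ioc (a n) (b n - (k + 1)), O i k‖
        ≤ 1 / (n : ℝ) * (b n * w k) := by gcongr
      _ = b n / n * w k := by ring
      _ ≤ _ := by have := hw0 k; gcongr)
  rw [tsum_mul_left] at htsum
  have h := hdiag.add (htsum.const_mul 2)
  rw [show (t - s) * d + 2 * ((t - s) * ∑' k, o k) = (d + 2 * ∑' k, o k) * (t - s) by ring] at h
  refine h.congr fun n => ?_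
  have hsum : ∑' k, 1 / (n : ℝ) * ∑ i ∈ Finset.Ioc (a n) (b n - (k + 1)), O i k =
      1 / (n : ℝ) * ∑ i ∈ Finset.Ioc (a n) (b n), ∑ k ∈ Finset.range (b n - i), O i k := by
    rw [tsum_mul_left, tsum_eq_sum (s := Finset.range (b n)) (fun k hk => by
      rw [Finset.mem_range] at hk
      rw [Finset.Ioc_eq_empty (by omega), Finset.sum_empty])]
    congr 1
    refine Finset.sum_comm' fun k i => ?_
    simp only [Finset.mem_range, Finset.mem_Ioc]
    omega
  rw [hsum]
  ring

/-- The covariance kernel `covK` without its normalizing factor. -/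
noncomputable def sqrtKernel (x y : ℝ) : ℝ := Real.sqrt (y + x) - Real.sqrt |y - x|

/-- The rectangular increment of `sqrtKernel` over the unit cell with upper corner `(i, j)`. -/
noncomputable def incrCov (i j : ℕ) : ℝ :=
  sqrtKernel i j - sqrtKernel (i - 1) j - sqrtKernel i (j - 1) + sqrtKernel (i - 1) (j - 1)

theorem sqrtKernel_comm (x y : ℝ) : sqrtKernel x y = sqrtKernel y x := by
  rw [sqrtKernel, sqrtKernel, add_comm, abs_sub_comm]

theorem incrCov_comm (i j : ℕ) : incrCov i j = incrCov j i := by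
  rw [incrCov, incrCov, sqrtKernel_comm i j, sqrtKernel_comm (i - 1) j, sqrtKernel_comm i (j - 1),
    sqrtKernel_comm (i - 1) (j - 1)]
  ring

theorem covK_div_div {x y n : ℝ} (hn : 0 ≤ n) :
    covK (x / n) (y / n) = ((Real.sqrt (2 * Real.pi))⁻¹ / Real.sqrt n) * sqrtKernel x y := by
  rw [covK, sqrtKernel, ← add_div, ← sub_div, abs_div, abs_of_nonneg hn, Real.sqrt_div' _ hn,
    Real.sqrt_div' _ hn]
  ring

theorem incrCov_self (i : ℕ) : incrCov i i = 2 - sqrtDiff (2 * i - 1) := by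
  simp only [incrCov, sqrtKernel, sqrtDiff]
  rw [show (i : ℝ) + (i - 1) = 2 * i - 1 by ring, show (i : ℝ) - 1 + i = 2 * i - 1 by ring,
    show (i : ℝ) + i = 2 * i - 1 + 1 by ring, show (i : ℝ) - 1 + (i - 1) = 2 * i - 1 - 1 by ring,
    show (i : ℝ) - (i - 1) = 1 by ring, show (i : ℝ) - 1 - i = -1 by ring]
  simp
  ring

theorem incrCov_lag (i k : ℕ) :
    incrCov i (i + 1 + k) = -(sqrtDiff (2 * i + k) + sqrtDiff (k + 1)) := by
  have hk : (0 : ℝ) ≤ k := k.cast_nonneg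
  simp only [incrCov, sqrtKernel, sqrtDiff]
  push_cast
  rw [show (i : ℝ) + 1 + k - i = k + 1 by ring, show (i : ℝ) + 1 + k - (i - 1) = k + 1 + 1 by ring,
    show (i : ℝ) + 1 + k - 1 - i = k by ring, show (i : ℝ) + 1 + k - 1 - (i - 1) = k + 1 by ring,
    show (i : ℝ) + 1 + k + i = 2 * i + k + 1 by ring,
    show (i : ℝ) + 1 + k + (i - 1) = 2 * i + k by ring,
    show (i : ℝ) + 1 + k - 1 + i = 2 * i + k by ring,
    show (i : ℝ) + 1 + k - 1 + (i - 1) = 2 * i + k - 1 by ring,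
    abs_of_nonneg hk, abs_of_nonneg (by positivity : (0 : ℝ) ≤ k + 1),
    abs_of_nonneg (by positivity : (0 : ℝ) ≤ k + 1 + 1), add_sub_cancel_right]
  ring

theorem sqrt_two_le_incrCov_self {i : ℕ} (hi : 1 ≤ i) : Real.sqrt 2 ≤ incrCov i i := by
  have hi' : (1 : ℝ) ≤ i := by exact_mod_cast hi
  rw [incrCov_self]
  linarith [sqrtDiff_le (show (1 : ℝ) ≤ 2 * i - 1 by linarith)]

theorem incrCov_self_le_two {i : ℕ} (hi : 1 ≤ i) : incrCov i i ≤ 2 := by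
  have hi' : (1 : ℝ) ≤ i := by exact_mod_cast hi
  rw [incrCov_self]
  linarith [sqrtDiff_nonneg (show (1 : ℝ) ≤ 2 * i - 1 by linarith)]

theorem incrCov_self_pos {i : ℕ} (hi : 1 ≤ i) : 0 < incrCov i i :=
  (Real.sqrt_pos.2 two_pos).trans_le (sqrt_two_le_incrCov_self hi)

theorem sqrt_two_le_sqrt_mul_sqrt {i j : ℕ} (hi : 1 ≤ i) (hj : 1 ≤ j) :
    Real.sqrt 2 ≤ Real.sqrt (incrCov i i) * Real.sqrt (incrCov j j) := by
  rw [← Real.sqrt_mul (incrCov_self_pos hi).le]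
  refine Real.sqrt_le_sqrt ?_
  calc (2 : ℝ) = Real.sqrt 2 * Real.sqrt 2 := by norm_num
    _ ≤ _ := mul_le_mul (sqrt_two_le_incrCov_self hi) (sqrt_two_le_incrCov_self hj)
      (Real.sqrt_nonneg _) (incrCov_self_pos hi).le

theorem abs_incrCov_lag_le {i : ℕ} (k : ℕ) (hi : 1 ≤ i) :
    |incrCov i (i + 1 + k)| ≤ 2 * sqrtDiff (k + 1) := by
  have hi' : (1 : ℝ) ≤ i := by exact_mod_cast hi
  have hk : (0 : ℝ) ≤ k := k.cast_nonneg
  have h := sqrtDiff_le_sqrtDiff (show (1 : ℝ) ≤ k + 1 by linarith)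
    (show (k : ℝ) + 1 ≤ 2 * i + k by linarith)
  rw [incrCov_lag, abs_neg, abs_of_nonneg (add_nonneg
    (sqrtDiff_nonneg (by linarith)) (sqrtDiff_nonneg (by linarith)))]
  linarith

theorem abs_incrCov_le {i j : ℕ} (hi : 1 ≤ i) (hj : 1 ≤ j) :
    |incrCov i j| ≤ Real.sqrt (incrCov i i) * Real.sqrt (incrCov j j) := by
  have hs : (1.4 : ℝ) ≤ Real.sqrt 2 := Real.le_sqrt_of_sq_le (by norm_num)
  have key : ∀ {i : ℕ} (k : ℕ), 1 ≤ i → |incrCov i (i + 1 + k)| ≤ Real.sqrt 2 := by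
    intro i k hi
    have h1 := abs_incrCov_lag_le k hi
    have h2 := sqrtDiff_le (show (1 : ℝ) ≤ k + 1 by simp)
    linarith
  rcases lt_trichotomy i j with h | rfl | h
  · obtain ⟨k, rfl⟩ := Nat.exists_eq_add_of_lt h
    rw [show i + k + 1 = i + 1 + k by ring] at hj ⊢
    exact (key k hi).trans (sqrt_two_le_sqrt_mul_sqrt hi hj)
  · rw [Real.mul_self_sqrt (incrCov_self_pos hi).le, abs_of_pos (incrCov_self_pos hi)]
  · obtain ⟨k, rfl⟩ := Nat.exists_eq_add_of_lt h
    rw [show j + k + 1 = j + 1 + k by ring] at hi ⊢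
    rw [incrCov_comm]
    exact (key k hj).trans (sqrt_two_le_sqrt_mul_sqrt hi hj)

/-- The moment `E[ΔF_i|ΔF_i| ΔF_j|ΔF_j|]` for time step `1`. -/
noncomputable def signedMoment (i j : ℕ) : ℝ :=
  (2 * Real.pi)⁻¹ * (incrCov i i * incrCov j j) *
    K0 (incrCov i j / (Real.sqrt (incrCov i i) * Real.sqrt (incrCov j j)))

theorem signedMoment_comm (i j : ℕ) : signedMoment i j = signedMoment j i := by
  rw [signedMoment, signedMoment, incrCov_comm i j, mul_comm (incrCov i i),
    mul_comm (Real.sqrt (incrCov i i))]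

theorem abs_signedMoment_lag_le {i : ℕ} (k : ℕ) (hi : 1 ≤ i) :
    |signedMoment i (i + 1 + k)| ≤ 40 * sqrtDiff (k + 1) := by
  have hj : 1 ≤ i + 1 + k := by omega
  have hg := sqrtDiff_nonneg (show (1 : ℝ) ≤ k + 1 by simp)
  have hVi := incrCov_self_pos hi
  have hVj := incrCov_self_pos hj
  have hs : 1 ≤ Real.sqrt (incrCov i i) * Real.sqrt (incrCov (i + 1 + k) (i + 1 + k)) :=
    (Real.one_le_sqrt.2 one_le_two).trans (sqrt_two_le_sqrt_mul_sqrt hi hj)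
  set σ := Real.sqrt (incrCov i i) * Real.sqrt (incrCov (i + 1 + k) (i + 1 + k)) with hσ
  have hr : |incrCov i (i + 1 + k) / σ| ≤ 1 := by
    rw [abs_div, abs_of_nonneg (by linarith : 0 ≤ σ), div_le_one (by linarith)]
    exact abs_incrCov_le hi hj
  have hr' : |incrCov i (i + 1 + k) / σ| ≤ 2 * sqrtDiff (k + 1) := by
    rw [abs_div, abs_of_nonneg (by linarith : 0 ≤ σ)]
    exact (div_le_self (abs_nonneg _) hs).trans (abs_incrCov_lag_le k hi)
  have hpi : (2 * Real.pi)⁻¹ ≤ 1 := inv_le_one_of_one_le₀ (by linarith [Real.pi_gt_three])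
  rw [signedMoment, ← hσ, abs_mul, abs_of_nonneg (by positivity)]
  calc (2 * Real.pi)⁻¹ * (incrCov i i * incrCov (i + 1 + k) (i + 1 + k)) *
        |K0 (incrCov i (i + 1 + k) / σ)|
      ≤ 1 * (2 * 2) * (5 * (2 * sqrtDiff (k + 1))) := by
        gcongr
        · exact incrCov_self_le_two hi
        · exact incrCov_self_le_two hj
        · exact (abs_K0_le hr).trans (by gcongr)
    _ = _ := by ring

theorem tendsto_incrCov_self : Tendsto (fun i => incrCov i i) atTop (nhds 2) := by
  simp_rw [incrCov_self]
  have h : Tendsto (fun i : ℕ => 2 * (i : ℝ) - 1) atTop atTop :=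
    tendsto_atTop_add_const_right _ _ (tendsto_natCast_atTop_atTop.const_mul_atTop two_pos)
  simpa using (tendsto_sqrtDiff_atTop.comp h).const_sub 2

theorem tendsto_signedMoment_self :
    Tendsto (fun i => signedMoment i i) atTop (nhds (6 / Real.pi)) := by
  have h : Tendsto (fun i => (2 * Real.pi)⁻¹ * (incrCov i i * incrCov i i) * 3) atTop
      (nhds ((2 * Real.pi)⁻¹ * (2 * 2) * 3)) :=
    ((tendsto_incrCov_self.mul tendsto_incrCov_self).const_mul _).mul_const _
  rw [show (2 * Real.pi)⁻¹ * (2 * 2) * 3 = 6 / Real.pi by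
    have := Real.pi_pos.ne'
    field_simp; norm_num] at h
  refine h.congr' ?_
  filter_upwards [eventually_ge_atTop 1] with i hi
  have hV := incrCov_self_pos hi
  rw [signedMoment, Real.mul_self_sqrt hV.le, div_self hV.ne', K0_one]

theorem tendsto_signedMoment_lag (k : ℕ) :
    Tendsto (fun i => signedMoment i (i + 1 + k)) atTop
      (nhds (-(2 / Real.pi) * K0 (gam (k + 1) / 2))) := by
  have hgam : gam (k + 1) = sqrtDiff (k + 1) := by
    simp only [gam, sqrtDiff, Nat.cast_add, Nat.cast_one]
  have hV := tendsto_incrCov_self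
  have hVk : Tendsto (fun i => incrCov (i + 1 + k) (i + 1 + k)) atTop (nhds 2) :=
    tendsto_incrCov_self.comp (tendsto_atTop_mono (fun i => by
      show i ≤ i + 1 + k; omega) tendsto_id)
  have harg : Tendsto (fun i : ℕ => 2 * (i : ℝ) + k) atTop atTop :=
    tendsto_atTop_add_const_right _ _ (tendsto_natCast_atTop_atTop.const_mul_atTop two_pos)
  have hq : Tendsto (fun i => incrCov i (i + 1 + k)) atTop (nhds (-(0 + sqrtDiff (k + 1)))) := by
    simp_rw [incrCov_lag]
    exact ((tendsto_sqrtDiff_atTop.comp harg).add_const _).neg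
  have hs : Real.sqrt 2 * Real.sqrt 2 = 2 := by norm_num
  have hr := hq.div (hV.sqrt.mul hVk.sqrt) (by rw [hs]; norm_num)
  have h := ((hV.mul hVk).const_mul (2 * Real.pi)⁻¹).mul ((continuous_K0.tendsto _).comp hr)
  rw [hs, zero_add, neg_div, K0_neg, ← hgam, show (2 * Real.pi)⁻¹ * (2 * 2) * -K0 (gam (k + 1) / 2)
    = -(2 / Real.pi) * K0 (gam (k + 1) / 2) by
      have := Real.pi_pos.ne'
      field_simp] at h
  exact h

namespace IsHeatGaussian

variable {Ω : Type*} [MeasurableSpace Ω] {P : Measure Ω} {F : ℝ → Ω → ℝ}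

theorem map_linear_increments (hF : IsHeatGaussian P F) {n i j : ℕ} (hi : 1 ≤ i) (hj : 1 ≤ j)
    (a b : ℝ) :
    P.map (fun ω => a * (F ((i : ℝ) / n) ω - F (((i : ℝ) - 1) / n) ω) +
        b * (F ((j : ℝ) / n) ω - F (((j : ℝ) - 1) / n) ω)) =
      gaussianReal 0 (Real.toNNReal
        (a ^ 2 * ((Real.sqrt (2 * Real.pi))⁻¹ / Real.sqrt n * incrCov i i) +
        2 * a * b * ((Real.sqrt (2 * Real.pi))⁻¹ / Real.sqrt n * incrCov i j) +
        b ^ 2 * ((Real.sqrt (2 * Real.pi))⁻¹ / Real.sqrt n * incrCov j j))) := by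
  have hi' : (1 : ℝ) ≤ i := by exact_mod_cast hi
  have hj' : (1 : ℝ) ≤ j := by exact_mod_cast hj
  have hn : (0 : ℝ) ≤ n := n.cast_nonneg
  have h := hF.2.2 4 ![(i : ℝ) / n, ((i : ℝ) - 1) / n, (j : ℝ) / n, ((j : ℝ) - 1) / n]
    ![a, -a, b, -b] (by
      intro l
      fin_cases l
      · exact div_nonneg (by linarith) hn
      · exact div_nonneg (by linarith) hn
      · exact div_nonneg (by linarith) hn
      · exact div_nonneg (by linarith) hn)
  simp only [Fin.sum_univ_four, Matrix.cons_val, covK_div_div hn] at h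
  convert h using 2
  · funext ω
    ring
  · congr 1
    simp only [incrCov]
    rw [sqrtKernel_comm j i, sqrtKernel_comm j (i - 1), sqrtKernel_comm (j - 1) i,
      sqrtKernel_comm (j - 1) (i - 1), sqrtKernel_comm (i - 1) i, sqrtKernel_comm (j - 1) j]
    ring

theorem integral_increments (hF : IsHeatGaussian P F) {n i j : ℕ} (hn : 1 ≤ n)
    (hi : 1 ≤ i) (hj : 1 ≤ j) :
    ∫ ω, ((F ((i : ℝ) / n) ω - F (((i : ℝ) - 1) / n) ω) *
          |F ((i : ℝ) / n) ω - F (((i : ℝ) - 1) / n) ω|) *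
        ((F ((j : ℝ) / n) ω - F (((j : ℝ) - 1) / n) ω) *
          |F ((j : ℝ) / n) ω - F (((j : ℝ) - 1) / n) ω|) ∂P =
      1 / (n : ℝ) * signedMoment i j := by
  have : IsProbabilityMeasure P := hF.1
  have hn' : (0 : ℝ) < n := by exact_mod_cast hn
  have hpi := Real.pi_pos
  have hVi := incrCov_self_pos hi
  have hVj := incrCov_self_pos hj
  set c := (Real.sqrt (2 * Real.pi))⁻¹ / Real.sqrt n with hc
  have hc0 : 0 < c := by positivity
  have hsq : Real.sqrt (c * incrCov i i) * Real.sqrt (c * incrCov j j) =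
      c * (Real.sqrt (incrCov i i) * Real.sqrt (incrCov j j)) := by
    rw [Real.sqrt_mul hc0.le, Real.sqrt_mul hc0.le]
    linear_combination (Real.sqrt (incrCov i i) * Real.sqrt (incrCov j j)) *
      Real.mul_self_sqrt hc0.le
  have h := integral_signed_sq_mul_signed_sq
    (X := fun ω => F ((i : ℝ) / n) ω - F (((i : ℝ) - 1) / n) ω)
    (Y := fun ω => F ((j : ℝ) / n) ω - F (((j : ℝ) - 1) / n) ω)
    ((hF.2.1 _).sub (hF.2.1 _)) ((hF.2.1 _).sub (hF.2.1 _))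
    (A := c * incrCov i i) (B := c * incrCov i j) (C := c * incrCov j j)
    (by positivity) (by positivity)
    (by
      rw [hsq, abs_mul, abs_of_pos hc0]
      have := abs_incrCov_le hi hj
      gcongr)
    (hF.map_linear_increments hi hj)
  rw [h, hsq, mul_div_mul_left _ _ hc0.ne', signedMoment]
  have hcc : c * c = (2 * Real.pi)⁻¹ * (1 / n) := by
    rw [hc, div_mul_div_comm, ← mul_inv, Real.mul_self_sqrt (by positivity),
      Real.mul_self_sqrt hn'.le]
    ring
  linear_combination (incrCov i i * incrCov j j *
    K0 (incrCov i j / (Real.sqrt (incrCov i i) * Real.sqrt (incrCov j j)))) * hcc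

theorem memLp_increment (hF : IsHeatGaussian P F) {n i : ℕ} (hi : 1 ≤ i) :
    MemLp (fun ω => (F ((i : ℝ) / n) ω - F (((i : ℝ) - 1) / n) ω) *
      |F ((i : ℝ) / n) ω - F (((i : ℝ) - 1) / n) ω|) 2 P := by
  have h := hF.map_linear_increments (n := n) hi hi 1 0
  simp only [one_mul, zero_mul, add_zero] at h
  exact memLp_signed_sq_of_map_eq_gaussianReal ((hF.2.1 _).sub (hF.2.1 _)) h

theorem integral_sum_sq (hF : IsHeatGaussian P F) {n : ℕ} (hn : 1 ≤ n) (a b : ℕ) :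
    ∫ ω, (∑ j ∈ Finset.Icc (a + 1) b, (F ((j : ℝ) / n) ω - F (((j : ℝ) - 1) / n) ω) *
        |F ((j : ℝ) / n) ω - F (((j : ℝ) - 1) / n) ω|) ^ 2 ∂P =
      1 / (n : ℝ) * ∑ i ∈ Finset.Ioc a b, ∑ j ∈ Finset.Ioc a b, signedMoment i j := by
  have hone : ∀ i ∈ Finset.Ioc a b, 1 ≤ i := fun i hi => by
    rw [Finset.mem_Ioc] at hi
    omega
  rw [show Finset.Icc (a + 1) b = Finset.Ioc a b from Finset.Icc_add_one_left_eq_Ioc a b]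
  simp_rw [sq, Finset.sum_mul_sum]
  have hint : ∀ i ∈ Finset.Ioc a b, ∀ j ∈ Finset.Ioc a b, Integrable (fun ω =>
      ((F ((i : ℝ) / n) ω - F (((i : ℝ) - 1) / n) ω) *
          |F ((i : ℝ) / n) ω - F (((i : ℝ) - 1) / n) ω|) *
        ((F ((j : ℝ) / n) ω - F (((j : ℝ) - 1) / n) ω) *
          |F ((j : ℝ) / n) ω - F (((j : ℝ) - 1) / n) ω|)) P := fun i hi j hj =>
    (hF.memLp_increment (hone i hi)).integrable_mul (hF.memLp_increment (hone j hj))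
  rw [integral_finsetSum _ fun i hi => integrable_finsetSum _ (hint i hi), Finset.mul_sum]
  refine Finset.sum_congr rfl fun i hi => ?_
  rw [integral_finsetSum _ (hint i hi), Finset.mul_sum]
  exact Finset.sum_congr rfl fun j hj => hF.integral_increments hn (hone i hi) (hone j hj)

end IsHeatGaussian

/-- Proposition 4.4 (variance limit): with `ΔF_j = F(j/n) − F((j−1)/n)`, for all
`0 ≤ s < t`, `E|∑_{j=⌊ns⌋+1}^{⌊nt⌋} ΔF_j²sgn(ΔF_j)|² → κ²(t−s)` where
`κ² = 6/π − (4/π)∑_{i=1}^∞ K₀(γ_i/2)`. (Here `ΔF_j²sgn(ΔF_j) = ΔF_j|ΔF_j|`.) -/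
theorem signed_quadratic_variation_variance_limit {Ω : Type*} [MeasurableSpace Ω]
    (P : Measure Ω) (F : ℝ → Ω → ℝ) (hF : IsHeatGaussian P F)
    (s t : ℝ) (hs : 0 ≤ s) (hst : s < t) :
    Tendsto (fun n : ℕ => ∫ ω,
        (∑ j ∈ Finset.Icc (⌊(n : ℝ) * s⌋₊ + 1) ⌊(n : ℝ) * t⌋₊,
          (F ((j : ℝ) / n) ω - F (((j : ℝ) - 1) / n) ω) *
            |F ((j : ℝ) / n) ω - F (((j : ℝ) - 1) / n) ω|) ^ 2 ∂P)
      atTop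
      (nhds ((6 / Real.pi - 4 / Real.pi * ∑' i : ℕ, K0 (gam (i + 1) / 2)) *
        (t - s))) := by
  have hfloor : ∀ r : ℝ, 0 ≤ r →
      Tendsto (fun n : ℕ => (⌊(n : ℝ) * r⌋₊ : ℝ) / n) atTop (nhds r) := fun r hr => by
    simpa only [mul_comm, Function.comp_def] using
      (tendsto_nat_floor_mul_div_atTop hr).comp (tendsto_natCast_atTop_atTop (R := ℝ))
  have h := tendsto_div_mul_sum_diag_add_lags hst (hfloor s hs) (hfloor t (hs.trans hst.le))
    tendsto_signedMoment_self tendsto_signedMoment_lag (summable_sqrtDiff.mul_left 40)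
    (fun i k hi => abs_signedMoment_lag_le k hi)
  rw [tsum_mul_left, show 6 / Real.pi + 2 * (-(2 / Real.pi) * ∑' k : ℕ, K0 (gam (k + 1) / 2)) =
    6 / Real.pi - 4 / Real.pi * ∑' i : ℕ, K0 (gam (i + 1) / 2) by ring] at h
  refine h.congr' ?_
  filter_upwards [eventually_ge_atTop 1] with n hn
  rw [hF.integral_sum_sq hn, sum_sum_Ioc_of_symm _ _ _ signedMoment_comm]
end
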